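/- Fix an integer i ≥ 3. Let δ1 and δ2 be the substitutions on {a,b,c} given by δ1(a)=a^i b, δ1(b)=a^{i-1} c, δ1(c)=a and δ2(a)=a b a^{i-1}, δ2(b)=a c a^{i-2}, δ2(c)=a (which have the same incidence matrix). Let φ be the substitution on {A,B,C,D,E,F} given by φ(A)=AB, φ(B)=AC, φ(C)=(AAD)^{i-1}·[AAE(AAD)^i]^{i-2}·AAE(AAD)^{i-1}·A, φ(D)=AF, φ(E)=(AAD)^{i-3}·A, φ(F)=(AAD)^{i-1}·[AAE(AAD)^i]^{i-3}·AAE(AAD)^{i-1}·A, and let p1, p2 be the monoid morphisms to words over {a,b,c} given by p1(A)=a, p1(B)=a^{i-1}b, p1(C)=a^{i-1}b(a^i b)^{i-2}a^{i-1}c, p1(D)=a^{i-2}b, p1(E)=a^{i-3}c, p1(F)=a^{i-1}b(a^i b)^{i-3}a^{i-1}c and p2(A)=a, p2(B)=b a^{i-1}, p2(C)=c a^{i-1}(b a^i)^{i-2} b a^{i-1}, p2(D)=b a^{i-2}, p2(E)=c a^{i-3}, p2(F)=c a^{i-1}(b a^i)^{i-3} b a^{i-1}. Then for every n ∈ ℕ,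 p1(φ^n(A)) = δ1^n(a) and p2(φ^n(A)) = δ2^n(a). -/

import Mathlib

/- STATEMENT 9: For every i ≥ 3, the morphism φ_i on the balanced-block
alphabet {A,...,F} generates the fixed points of δ_i^1 and δ_i^2 via the
projections p1, p2. -/

namespace Stmt9

inductive ABC : Type
  | a | b | c
deriving DecidableEq

inductive L : Type
  | A | B | C | D | E | F
deriving DecidableEq

/-- Extension of a letter-to-word map to a morphism of free monoids. -/
def subst {α β : Type} (f : α → List β) (w : List α) : List β :=
  w.flatMap f

/-- `wpow w k` is the `k`-fold concatenation of the word `w`. -/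
def wpow {α : Type} (w : List α) (k : ℕ) : List α :=
  (List.replicate k w).flatten

/-- δ_i^1 : a → a^i b, b → a^{i-1} c, c → a. -/
def δ1 (i : ℕ) : ABC → List ABC
  | .a => List.replicate i .a ++ [.b]
  | .b => List.replicate (i - 1) .a ++ [.c]
  | .c => [.a]

/-- δ_i^2 : a → a b a^{i-1}, b → a c a^{i-2}, c → a. -/
def δ2 (i : ℕ) : ABC → List ABC
  | .a => [.a, .b] ++ List.replicate (i - 1) .a
  | .b => [.a, .c] ++ List.replicate (i - 2) .a
  | .c => [.a]

def AAD : List L := [.A, .A, .D]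
def AAE : List L := [.A, .A, .E]

def φ (i : ℕ) : L → List L
  | .A => [.A, .B]
  | .B => [.A, .C]
  | .C => wpow AAD (i - 1) ++ wpow (AAE ++ wpow AAD i) (i - 2) ++ AAE ++ wpow AAD (i - 1) ++ [.A]
  | .D => [.A, .F]
  | .E => wpow AAD (i - 3) ++ [.A]
  | .F => wpow AAD (i - 1) ++ wpow (AAE ++ wpow AAD i) (i - 3) ++ AAE ++ wpow AAD (i - 1) ++ [.A]

def p1 (i : ℕ) : L → List ABC
  | .A => [.a]
  | .B => List.replicate (i - 1) .a ++ [.b]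
  | .C => List.replicate (i - 1) .a ++ [.b] ++ wpow (List.replicate i .a ++ [.b]) (i - 2)
            ++ List.replicate (i - 1) .a ++ [.c]
  | .D => List.replicate (i - 2) .a ++ [.b]
  | .E => List.replicate (i - 3) .a ++ [.c]
  | .F => List.replicate (i - 1) .a ++ [.b] ++ wpow (List.replicate i .a ++ [.b]) (i - 3)
            ++ List.replicate (i - 1) .a ++ [.c]

def p2 (i : ℕ) : L → List ABC
  | .A => [.a]
  | .B => [.b] ++ List.replicate (i - 1) .a
  | .C => [.c] ++ List.replicate (i - 1) .a ++ wpow ([.b] ++ List.replicate i .a) (i - 2)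
            ++ [.b] ++ List.replicate (i - 1) .a
  | .D => [.b] ++ List.replicate (i - 2) .a
  | .E => [.c] ++ List.replicate (i - 3) .a
  | .F => [.c] ++ List.replicate (i - 1) .a ++ wpow ([.b] ++ List.replicate i .a) (i - 3)
            ++ [.b] ++ List.replicate (i - 1) .a

theorem subst_nil {α β : Type} (f : α → List β) : subst f [] = [] := rfl

theorem subst_cons {α β : Type} (f : α → List β) (x : α) (w : List α) :
    subst f (x :: w) = f x ++ subst f w := rfl

theorem subst_append {α β : Type} (f : α → List β) (u v : List α) :
    subst f (u ++ v) = subst f u ++ subst f v := by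
  simp [subst]

theorem subst_subst {α β γ : Type} (g : β → List γ) (f : α → List β) (w : List α) :
    subst g (subst f w) = subst (fun x => subst g (f x)) w := by
  simp [subst, List.flatMap_assoc]

theorem wpow_zero {α : Type} (w : List α) : wpow w 0 = [] := rfl

theorem wpow_succ {α : Type} (w : List α) (n : ℕ) : wpow w (n + 1) = w ++ wpow w n := by
  simp [wpow, List.replicate_succ]

theorem subst_wpow {α β : Type} (f : α → List β) (w : List α) (n : ℕ) :
    subst f (wpow w n) = wpow (subst f w) n := by
  induction n with
  | zero => rfl
  | succ n ih => rw [wpow_succ, wpow_succ, subst_append, ih]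

theorem subst_replicate {α β : Type} (f : α → List β) (x : α) (n : ℕ) :
    subst f (List.replicate n x) = wpow (f x) n := by
  simp [subst, wpow, List.flatMap]

/-- If `w` is conjugate to `w'` through `x`, then so are their powers. -/
theorem wpow_append_of_append_eq {α : Type} {w w' x : List α} (h : w ++ x = x ++ w') (n : ℕ) :
    wpow w n ++ x = x ++ wpow w' n := by
  induction n with
  | zero => simp [wpow_zero]
  | succ n ih => rw [wpow_succ, wpow_succ, List.append_assoc, ih, ← List.append_assoc, h,
      List.append_assoc]

theorem wpow_append_shift {α : Type} (u v : List α) (n : ℕ) :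
    wpow (u ++ v) n ++ u = u ++ wpow (v ++ u) n :=
  wpow_append_of_append_eq (List.append_assoc u v u) n

theorem iterate_subst_comm {α β : Type} {p : α → List β} {f : α → List α} {d : β → List β}
    (h : ∀ x, subst p (f x) = subst d (p x)) (n : ℕ) (w : List α) :
    subst p ((subst f)^[n] w) = (subst d)^[n] (subst p w) := by
  have hs : Function.Semiconj (subst p) (subst f) (subst d) := fun w => by
    rw [subst_subst, subst_subst]
    exact congrArg (fun g => subst g w) (funext h)
  exact hs.iterate_right n w

theorem subst_p1_AAD (k : ℕ) : subst (p1 (k + 3)) AAD = δ1 (k + 3) .a := by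
  simp [AAD, subst_cons, subst_nil, p1, δ1, List.replicate_succ]

theorem subst_p1_AAE (k : ℕ) : subst (p1 (k + 3)) AAE = δ1 (k + 3) .b := by
  simp [AAE, subst_cons, subst_nil, p1, δ1, List.replicate_succ]

theorem subst_p2_AAD_append (k : ℕ) :
    subst (p2 (k + 3)) AAD ++ [.a] = [.a] ++ δ2 (k + 3) .a := by
  simp [AAD, subst_cons, subst_nil, p2, δ2, List.replicate_succ']

theorem subst_p2_AAE_append (k : ℕ) :
    subst (p2 (k + 3)) AAE ++ [.a] = [.a] ++ δ2 (k + 3) .b := by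
  simp [AAE, subst_cons, subst_nil, p2, δ2, List.replicate_succ']

theorem append_eq_of_append_eq {α : Type} {u u' v v' x : List α} (hu : u ++ x = x ++ u')
    (hv : v ++ x = x ++ v') : (u ++ v) ++ x = x ++ (u' ++ v') := by
  rw [List.append_assoc, hv, ← List.append_assoc, hu, List.append_assoc]

theorem cons_replicate_append_wpow {α : Type} (x y : α) (m n : ℕ) :
    x :: (List.replicate m x ++ y :: wpow (List.replicate (m + 1) x ++ [y]) n) =
      wpow (List.replicate (m + 1) x ++ [y]) (n + 1) := by
  simp [wpow_succ, List.replicate_succ]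

theorem replicate_append_wpow_append {α : Type} (x y : α) (m n : ℕ) :
    List.replicate (m + 1) x ++ (wpow (y :: List.replicate (m + 2) x) n ++
        y :: List.replicate (m + 1) x) =
      List.replicate m x ++ wpow (x :: y :: List.replicate (m + 1) x) (n + 1) := by
  have h := wpow_append_shift (y :: List.replicate (m + 1) x) [x] n
  rw [show y :: List.replicate (m + 1) x ++ [x] = y :: List.replicate (m + 2) x by
    simp [List.replicate_succ' (n := m + 1)]] at h
  rw [h, wpow_succ, List.replicate_succ']
  simp

theorem subst_p1_φ (k : ℕ) (x : L) :
    subst (p1 (k + 3)) (φ (k + 3) x) = subst (δ1 (k + 3)) (p1 (k + 3) x) := by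
  have key (n : ℕ) := wpow_append_shift (δ1 (k + 3) .b) (wpow (δ1 (k + 3) .a) (k + 3)) n
  cases x with
  | A => simp [φ, p1, δ1, subst_cons, subst_nil, List.replicate_succ]
  | B =>
    have h := cons_replicate_append_wpow ABC.a ABC.b (k + 2) (k + 1)
    simp [φ, p1, subst_cons, subst_nil, subst_append, subst_replicate, δ1, ← h]
  | D =>
    have h := cons_replicate_append_wpow ABC.a ABC.b (k + 2) k
    simp [φ, p1, subst_cons, subst_nil, subst_append, subst_replicate, δ1, ← h]
  | E => simp [φ, p1, subst_cons, subst_nil, subst_append, subst_wpow, subst_p1_AAD,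
      subst_replicate, δ1]
  | C | F =>
    simp only [φ, p1, subst_append, subst_wpow, subst_p1_AAD, subst_p1_AAE, subst_replicate,
      subst_cons, subst_nil, List.append_nil, Nat.add_sub_cancel, Nat.reduceSubDiff,
      List.append_assoc]
    rw [← List.append_assoc (wpow (_ ++ _) _) (δ1 (k + 3) .b), key]
    simp [δ1]

theorem subst_p2_φ (k : ℕ) (x : L) :
    subst (p2 (k + 3)) (φ (k + 3) x) = subst (δ2 (k + 3)) (p2 (k + 3) x) := by
  have hD (n : ℕ) := wpow_append_of_append_eq (subst_p2_AAD_append k) n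
  have hE := subst_p2_AAE_append k
  have hED (n : ℕ) := wpow_append_of_append_eq (append_eq_of_append_eq hE (hD (k + 3))) n
  have key (n : ℕ) := append_eq_of_append_eq (append_eq_of_append_eq (append_eq_of_append_eq
    (hD (k + 2)) (hED n)) hE) (hD (k + 2))
  cases x with
  | A => simp [φ, p2, δ2, subst_cons, subst_nil]
  | B =>
    have h := replicate_append_wpow_append ABC.a ABC.b (k + 1) (k + 1)
    simp [φ, p2, subst_cons, subst_nil, subst_replicate, δ2, h]
  | D =>
    have h := replicate_append_wpow_append ABC.a ABC.b (k + 1) k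
    simp [φ, p2, subst_cons, subst_nil, subst_replicate, δ2, h]
  | E =>
    simpa [φ, p2, subst_cons, subst_nil, subst_append, subst_wpow, subst_replicate, δ2] using hD k
  | C =>
    simpa [φ, p2, δ2, subst_cons, subst_nil, subst_append, subst_wpow, subst_replicate]
      using key (k + 1)
  | F =>
    simpa [φ, p2, δ2, subst_cons, subst_nil, subst_append, subst_wpow, subst_replicate]
      using key k

theorem phi_generates_common_points (i : ℕ) (hi : 3 ≤ i) :
    ∀ n : ℕ,
      subst (p1 i) ((subst (φ i))^[n] [L.A]) = (subst (δ1 i))^[n] [ABC.a] ∧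
      subst (p2 i) ((subst (φ i))^[n] [L.A]) = (subst (δ2 i))^[n] [ABC.a] := by
  obtain ⟨k, rfl⟩ := Nat.exists_eq_add_of_le' hi
  exact fun n => ⟨iterate_subst_comm (subst_p1_φ k) n [.A], iterate_subst_comm (subst_p2_φ k) n [.A]⟩

end Stmt9
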